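/- Let α > 0 be a real number with α ∉ √2·ℚ, with H₄-expansion data G_n = (t_n, v_n; u_n, w_n), α_n = (w_n·α − v_n)/(t_n − u_n·α), α*_n = w_n/u_n, and let n ≥ m(α)+1. If either (α*_n < 1 and 1 < α_n < √2) or (1 < α*_n < √2 and α_n < 1), then 1/((√2 + 1)·u_n²) < |α − t_n/u_n| < 1/u_n². -/

import Mathlib

/-- A matrix (p, r; q, s) has the first H4 form (without sign). -/
def H4form (p r q s : ℝ) : Prop :=
  (∃ a b c d : ℤ, Odd a ∧ Odd d ∧ a * d - 2 * b * c = 1 ∧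
     p = (a : ℝ) ∧ r = Real.sqrt 2 * b ∧ q = Real.sqrt 2 * c ∧ s = (d : ℝ)) ∨
  (∃ a b c d : ℤ, Odd b ∧ Odd c ∧ 2 * a * d - b * c = 1 ∧
     p = Real.sqrt 2 * a ∧ r = (b : ℝ) ∧ q = (c : ℝ) ∧ s = Real.sqrt 2 * d)

/-- The matrix (p, r; q, s) belongs to the Hecke group H4 (up to sign). -/
def H4 (p r q s : ℝ) : Prop := H4form p r q s ∨ H4form (-p) (-r) (-q) (-s)

/-- p/q ∈ ℚ(H₄): q > 0 and (p, r; q, s) ∈ H₄ for some reals r, s. -/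
def QH4 (p q : ℝ) : Prop := 0 < q ∧ ∃ r s : ℝ, H4 p r q s

/-- α ∉ √2·ℚ. -/
def NotSqrt2Rat (α : ℝ) : Prop := ¬ ∃ x : ℚ, α = Real.sqrt 2 * (x : ℝ)

/-- The matrices A₁, A₂, A₃ generating the H₄-expansion. -/
noncomputable def Amat : ℕ → Matrix (Fin 2) (Fin 2) ℝ
  | 1 => !![1, 0; Real.sqrt 2, 1]
  | 2 => !![Real.sqrt 2, 1; 1, Real.sqrt 2]
  | _ => !![1, Real.sqrt 2; 0, 1]

/-- G_n = A_{d₁} ⋯ A_{d_n}. -/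
noncomputable def Gmat (d : ℕ → ℕ) (n : ℕ) : Matrix (Fin 2) (Fin 2) ℝ :=
  ((List.range n).map (fun i => Amat (d (i + 1)))).prod

noncomputable def tn (d : ℕ → ℕ) (n : ℕ) : ℝ := Gmat d n 0 0
noncomputable def vn (d : ℕ → ℕ) (n : ℕ) : ℝ := Gmat d n 0 1
noncomputable def un (d : ℕ → ℕ) (n : ℕ) : ℝ := Gmat d n 1 0
noncomputable def wn (d : ℕ → ℕ) (n : ℕ) : ℝ := Gmat d n 1 1

/-- α_n = G_n⁻¹ · α. -/
noncomputable def alphan (d : ℕ → ℕ) (α : ℝ) (n : ℕ) : ℝ :=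
  (wn d n * α - vn d n) / (tn d n - un d n * α)

/-- α*_n = w_n / u_n. -/
noncomputable def alphast (d : ℕ → ℕ) (n : ℕ) : ℝ := wn d n / un d n

theorem Amat_eq (k : ℕ) : Amat k = !![1, 0; Real.sqrt 2, 1] ∨
    Amat k = !![Real.sqrt 2, 1; 1, Real.sqrt 2] ∨ Amat k = !![1, Real.sqrt 2; 0, 1] := by
  unfold Amat
  split <;> simp

theorem Amat_det (k : ℕ) : (Amat k).det = 1 := by
  unfold Amat
  split <;> simp [Matrix.det_fin_two]
  norm_num

theorem Gmat_zero (d : ℕ → ℕ) : Gmat d 0 = 1 := by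
  simp [Gmat]

theorem Gmat_succ (d : ℕ → ℕ) (n : ℕ) : Gmat d (n + 1) = Gmat d n * Amat (d (n + 1)) := by
  simp [Gmat, List.range_succ]

theorem Gmat_det (d : ℕ → ℕ) (n : ℕ) : (Gmat d n).det = 1 := by
  induction n with
  | zero => simp [Gmat_zero]
  | succ n ih => rw [Gmat_succ, Matrix.det_mul, ih, Amat_det, one_mul]

theorem un_nonneg_and_wn_pos (d : ℕ → ℕ) (n : ℕ) : 0 ≤ un d n ∧ 0 < wn d n := by
  induction n with
  | zero => simp [un, wn, Gmat_zero]
  | succ n ih =>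
    obtain ⟨hu, hw⟩ := ih
    simp only [un, wn] at hu hw
    simp only [un, wn, Gmat_succ, Matrix.mul_apply, Fin.sum_univ_two]
    rcases Amat_eq (d (n + 1)) with h | h | h <;> simp [h] <;> constructor <;> positivity

theorem un_pos {d : ℕ → ℕ} (hd : ∀ n : ℕ, 1 ≤ n → d n = 1 ∨ d n = 2 ∨ d n = 3) {m : ℕ}
    (hm1 : d (m + 1) ≠ 3) {n : ℕ} (hn : m + 1 ≤ n) : 0 < un d n := by
  induction n, hn using Nat.le_induction with
  | base =>
    obtain ⟨hu, hw⟩ := un_nonneg_and_wn_pos d m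
    simp only [un, wn] at hu hw
    simp only [un, Gmat_succ, Matrix.mul_apply, Fin.sum_univ_two]
    rcases hd (m + 1) (by omega) with h | h | h
    · simp [h, Amat]; positivity
    · simp [h, Amat]; positivity
    · exact absurd h hm1
  | succ n _ hu =>
    obtain ⟨-, hw⟩ := un_nonneg_and_wn_pos d n
    simp only [un, wn] at hu hw
    simp only [un, Gmat_succ, Matrix.mul_apply, Fin.sum_univ_two]
    rcases Amat_eq (d (n + 1)) with h | h | h <;> simp [h] <;> positivity

/-- The approximation error is governed by `α_n + α*_n`. -/
theorem abs_sub_div_eq {d : ℕ → ℕ} {α : ℝ} {n : ℕ} (hu : 0 < un d n)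
    (ht : un d n * α < tn d n) :
    |α - tn d n / un d n| = 1 / ((alphan d α n + alphast d n) * un d n ^ 2) := by
  have hdet : tn d n * wn d n - vn d n * un d n = 1 := by
    rw [← Gmat_det d n, Matrix.det_fin_two]; rfl
  have ht' : 0 < tn d n - un d n * α := sub_pos.2 ht
  have hsum : alphan d α n + alphast d n = 1 / (un d n * (tn d n - un d n * α)) := by
    unfold alphan alphast
    rw [div_add_div _ _ ht'.ne' hu.ne', mul_comm (un d n) (tn d n - un d n * α)]
    congr 1
    linear_combination hdet
  have hneg : α - tn d n / un d n = -((tn d n - un d n * α) / un d n) := by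
    field_simp
    ring
  rw [hsum, hneg, abs_neg, abs_of_pos (by positivity)]
  field_simp

theorem one_sided_approximation (α : ℝ) (hα : 0 < α) (hirr : NotSqrt2Rat α)
    (d : ℕ → ℕ)
    (hd : ∀ n : ℕ, 1 ≤ n → d n = 1 ∨ d n = 2 ∨ d n = 3)
    (hmem : ∀ n : ℕ, 1 ≤ n → vn d n < wn d n * α ∧ un d n * α < tn d n)
    (m : ℕ) (hm : ∀ n : ℕ, 1 ≤ n → n ≤ m → d n = 3) (hm1 : d (m + 1) ≠ 3)
    (n : ℕ) (hn : m + 1 ≤ n)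
    (hcase : (alphast d n < 1 ∧ 1 < alphan d α n ∧ alphan d α n < Real.sqrt 2) ∨
             (1 < alphast d n ∧ alphast d n < Real.sqrt 2 ∧ alphan d α n < 1)) :
    1 / ((Real.sqrt 2 + 1) * (un d n) ^ 2) < |α - tn d n / un d n| ∧
    |α - tn d n / un d n| < 1 / (un d n) ^ 2 := by
  have hu := un_pos hd hm1 hn
  obtain ⟨hv, ht⟩ := hmem n (by omega)
  have hx : 0 < alphan d α n := div_pos (sub_pos.2 hv) (sub_pos.2 ht)
  have hy : 0 < alphast d n := div_pos (un_nonneg_and_wn_pos d n).2 hu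
  have hlow : 1 < alphan d α n + alphast d n := by
    rcases hcase with ⟨_, _, _⟩ | ⟨_, _, _⟩ <;> linarith
  have hupp : alphan d α n + alphast d n < Real.sqrt 2 + 1 := by
    rcases hcase with ⟨_, _, _⟩ | ⟨_, _, _⟩ <;> linarith
  have hu2 : 0 < un d n ^ 2 := by positivity
  rw [abs_sub_div_eq hu ht]
  constructor
  · gcongr
  · apply one_div_lt_one_div_of_lt hu2
    exact lt_mul_of_one_lt_left hu2 hlow
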